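/- arXiv:2111.12343 — 2 statements merged into one kernel-verified Lean document; each statement's English description precedes it below -/
import Mathlib

section
/- Let G_1 and G_2 be connected k-regular graphs with |V(G_1)| = |V(G_2)| = n and Z(G_1) ≠ Z(G_2). For some m ≥ n, let G' = (G_1 ∨ P_m) ∪ G_2 and G'' = (G_2 ∨ P_m) ∪ G_1, where ∪ denotes disjoint union and P_m is the path on m vertices. Then G' and G'' are non-isomorphic graphs that are cospectral with respect to the adjacency matrix, and Z(G') ≠ Z(G''); in fact Z(G') = n + Z(G_2) + 1 and Z(G'') = n + Z(G_1) + 1. -/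
open SimpleGraph Matrix
open scoped Classical


/-- In the standard zero forcing process, a blue vertex `u` (in `B`) forces its unique
white neighbor `v`. -/
def StdForce {V : Type*} (G : SimpleGraph V) (B : Set V) (u v : V) : Prop :=
  u ∈ B ∧ v ∉ B ∧ G.Adj u v ∧ ∀ w, G.Adj u w → w ∉ B → w = v

/-- A set of blue vertices is closed (stalled) when no standard force is possible. -/
def ZFClosed {V : Type*} (G : SimpleGraph V) (B : Set V) : Prop :=
  ∀ u v, StdForce G B u v → v ∈ B

/-- `S` is a zero forcing set: iterating the color change rule from `S` colors every
vertex blue; equivalently, the only stalled superset of `S` is the whole vertex set. -/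
def IsZeroForcingSet {V : Type*} (G : SimpleGraph V) (S : Set V) : Prop :=
  ∀ B : Set V, S ⊆ B → ZFClosed G B → B = Set.univ

/-- The zero forcing number `Z(G)`. -/
noncomputable def zfNum {V : Type*} (G : SimpleGraph V) [Fintype V] : ℕ :=
  sInf {n | ∃ S : Finset V, IsZeroForcingSet G ↑S ∧ S.card = n}

/-- The join of two graphs: their disjoint union together with all edges between the
two parts. -/
def graphJoin {V W : Type*} (G : SimpleGraph V) (H : SimpleGraph W) :
    SimpleGraph (V ⊕ W) :=
  SimpleGraph.fromRel (fun x y =>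
    match x, y with
    | Sum.inl a, Sum.inl b => G.Adj a b
    | Sum.inr a, Sum.inr b => H.Adj a b
    | Sum.inl _, Sum.inr _ => True
    | Sum.inr _, Sum.inl _ => False)

/-- The disjoint union of two graphs. -/
def graphDisjUnion {V W : Type*} (G : SimpleGraph V) (H : SimpleGraph W) :
    SimpleGraph (V ⊕ W) :=
  SimpleGraph.fromRel (fun x y =>
    match x, y with
    | Sum.inl a, Sum.inl b => G.Adj a b
    | Sum.inr a, Sum.inr b => H.Adj a b
    | _, _ => False)

@[simp]
theorem graphJoin_adj_inl_inl {V W : Type*} {G : SimpleGraph V} {H : SimpleGraph W} {a b : V} :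
    (graphJoin G H).Adj (Sum.inl a) (Sum.inl b) ↔ G.Adj a b := by
  simpa [graphJoin, G.adj_comm b a] using fun h : G.Adj a b => h.ne

@[simp]
theorem graphJoin_adj_inr_inr {V W : Type*} {G : SimpleGraph V} {H : SimpleGraph W} {a b : W} :
    (graphJoin G H).Adj (Sum.inr a) (Sum.inr b) ↔ H.Adj a b := by
  simpa [graphJoin, H.adj_comm b a] using fun h : H.Adj a b => h.ne

@[simp]
theorem graphJoin_adj_inl_inr {V W : Type*} {G : SimpleGraph V} {H : SimpleGraph W}
    {a : V} {b : W} : (graphJoin G H).Adj (Sum.inl a) (Sum.inr b) := by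
  simp [graphJoin]

@[simp]
theorem graphJoin_adj_inr_inl {V W : Type*} {G : SimpleGraph V} {H : SimpleGraph W}
    {a : V} {b : W} : (graphJoin G H).Adj (Sum.inr b) (Sum.inl a) := by
  simp [graphJoin]

theorem graphDisjUnion_eq_sum {V W : Type*} (G : SimpleGraph V) (H : SimpleGraph W) :
    graphDisjUnion G H = G ⊕g H := by
  ext (a | a) (b | b)
  · simpa [graphDisjUnion, G.adj_comm b a] using fun h : G.Adj a b => h.ne
  · simp [graphDisjUnion]
  · simp [graphDisjUnion]
  · simpa [graphDisjUnion, H.adj_comm b a] using fun h : H.Adj a b => h.ne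

theorem isZeroForcingSet_univ {V : Type*} (G : SimpleGraph V) :
    IsZeroForcingSet G Set.univ :=
  fun _ h _ => Set.univ_subset_iff.mp h

theorem zfNum_le_card {V : Type*} [Fintype V] {G : SimpleGraph V} {S : Finset V}
    (hS : IsZeroForcingSet G ↑S) : zfNum G ≤ S.card :=
  Nat.sInf_le ⟨S, hS, rfl⟩

theorem exists_isZeroForcingSet_card_eq {V : Type*} [Fintype V] (G : SimpleGraph V) :
    ∃ S : Finset V, IsZeroForcingSet G ↑S ∧ S.card = zfNum G :=
  Nat.sInf_mem (s := {n | ∃ S : Finset V, IsZeroForcingSet G ↑S ∧ S.card = n})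
    ⟨_, Finset.univ, by simpa using isZeroForcingSet_univ G, rfl⟩

theorem ZFClosed.preimage_iso {V W : Type*} {G : SimpleGraph V} {H : SimpleGraph W} (e : G ≃g H)
    {B : Set W} (hB : ZFClosed H B) : ZFClosed G (e ⁻¹' B) := by
  rintro u v ⟨hu, hv, huv, hw⟩
  refine hB (e u) (e v) ⟨hu, hv, e.map_adj_iff.mpr huv, fun w hadj hwB => ?_⟩
  obtain ⟨w, rfl⟩ := e.surjective w
  exact congrArg e (hw w (e.map_adj_iff.mp hadj) hwB)

theorem zfNum_le_of_iso {V W : Type*} [Fintype V] [Fintype W] {G : SimpleGraph V}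
    {H : SimpleGraph W} (e : G ≃g H) : zfNum H ≤ zfNum G := by
  obtain ⟨S, hS, hcard⟩ := exists_isZeroForcingSet_card_eq G
  rw [← hcard, ← Finset.card_map e.toEquiv.toEmbedding]
  refine zfNum_le_card fun B hSB hB => ?_
  have h := hS (e ⁻¹' B) (fun x hx => hSB (by simpa using hx)) (hB.preimage_iso e)
  exact Set.eq_univ_of_forall fun w => by
    simpa using Set.eq_univ_iff_forall.mp h (e.symm w)

theorem zfNum_eq_of_iso {V W : Type*} [Fintype V] [Fintype W] {G : SimpleGraph V}
    {H : SimpleGraph W} (e : G ≃g H) : zfNum G = zfNum H :=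
  le_antisymm (zfNum_le_of_iso e.symm) (zfNum_le_of_iso e)

theorem zfClosed_sum_iff {V W : Type*} {G : SimpleGraph V} {H : SimpleGraph W}
    {B : Set (V ⊕ W)} :
    ZFClosed (G ⊕g H) B ↔ ZFClosed G (Sum.inl ⁻¹' B) ∧ ZFClosed H (Sum.inr ⁻¹' B) := by
  simp [ZFClosed, StdForce, Sum.forall]

theorem isZeroForcingSet_sum_iff {V W : Type*} {G : SimpleGraph V} {H : SimpleGraph W}
    {S : Set (V ⊕ W)} :
    IsZeroForcingSet (G ⊕g H) S ↔
      IsZeroForcingSet G (Sum.inl ⁻¹' S) ∧ IsZeroForcingSet H (Sum.inr ⁻¹' S) := by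
  constructor
  · refine fun hS => ⟨fun B hSB hB => ?_, fun B hSB hB => ?_⟩
    · have h := hS (Sum.inl '' B ∪ Set.range Sum.inr)
        (by rintro (a | a) ha
            · exact Or.inl ⟨a, hSB ha, rfl⟩
            · exact Or.inr ⟨a, rfl⟩)
        (zfClosed_sum_iff.mpr ⟨by
          simpa [Set.preimage_union, Set.preimage_image_eq _ Sum.inl_injective] using hB,
          by simp [ZFClosed]⟩)
      exact Set.eq_univ_of_forall fun v => by
        simpa using Set.eq_univ_iff_forall.mp h (Sum.inl v)
    · have h := hS (Set.range Sum.inl ∪ Sum.inr '' B)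
        (by rintro (a | a) ha
            · exact Or.inl ⟨a, rfl⟩
            · exact Or.inr ⟨a, hSB ha, rfl⟩)
        (zfClosed_sum_iff.mpr ⟨by simp [ZFClosed], by
          simpa [Set.preimage_union, Set.preimage_image_eq _ Sum.inr_injective] using hB⟩)
      exact Set.eq_univ_of_forall fun v => by
        simpa using Set.eq_univ_iff_forall.mp h (Sum.inr v)
  · rintro ⟨hG, hH⟩ B hSB hB
    rw [zfClosed_sum_iff] at hB
    have h₁ := Set.eq_univ_iff_forall.mp (hG _ (Set.preimage_mono hSB) hB.1)
    have h₂ := Set.eq_univ_iff_forall.mp (hH _ (Set.preimage_mono hSB) hB.2)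
    exact Set.eq_univ_of_forall (Sum.forall.mpr ⟨h₁, h₂⟩)

theorem zfNum_sum {V W : Type*} [Fintype V] [Fintype W] (G : SimpleGraph V)
    (H : SimpleGraph W) : zfNum (G ⊕g H) = zfNum G + zfNum H := by
  apply le_antisymm
  · obtain ⟨S, hS, hSc⟩ := exists_isZeroForcingSet_card_eq G
    obtain ⟨T, hT, hTc⟩ := exists_isZeroForcingSet_card_eq H
    rw [← hSc, ← hTc, ← Finset.card_disjSum]
    refine zfNum_le_card (isZeroForcingSet_sum_iff.mpr ⟨?_, ?_⟩)
    · convert hS using 1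
      ext; simp
    · convert hT using 1
      ext; simp
  · obtain ⟨S, hS, hSc⟩ := exists_isZeroForcingSet_card_eq (G ⊕g H)
    rw [isZeroForcingSet_sum_iff] at hS
    rw [← hSc, ← Finset.card_toLeft_add_card_toRight]
    refine add_le_add (zfNum_le_card ?_) (zfNum_le_card ?_)
    · convert hS.1 using 1
      ext; simp
    · convert hS.2 using 1
      ext; simp

theorem le_zfNum_of_forall_le_degree {V : Type*} [Fintype V] [Nonempty V] {G : SimpleGraph V}
    {d : ℕ} (hd : ∀ v, d ≤ G.degree v) : d ≤ zfNum G := by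
  obtain ⟨S, hS, hSc⟩ := exists_isZeroForcingSet_card_eq G
  rw [← hSc]
  by_cases hclosed : ZFClosed G ↑S
  · have huniv : S = Finset.univ := by exact_mod_cast hS _ subset_rfl hclosed
    obtain ⟨v⟩ := ‹Nonempty V›
    rw [huniv]
    exact (hd v).trans (Finset.card_le_univ _)
  · simp only [ZFClosed, not_forall] at hclosed
    obtain ⟨u, v, ⟨hu, hv, huv, hw⟩, -⟩ := hclosed
    have hsub : insert u ((G.neighborFinset u).erase v) ⊆ S := by
      intro x hx
      simp only [Finset.mem_insert, Finset.mem_erase, mem_neighborFinset] at hx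
      rcases hx with rfl | ⟨hxv, hx⟩
      · exact hu
      · by_contra hxS
        exact hxv (hw x hx hxS)
    have hcard := Finset.card_le_card hsub
    rw [Finset.card_insert_of_notMem (by simp),
      Finset.card_erase_of_mem (by simpa using huv), card_neighborFinset_eq_degree] at hcard
    have := hd u
    omega

theorem degree_graphJoin_inl {V W : Type*} [Fintype V] [Fintype W] (G : SimpleGraph V)
    (H : SimpleGraph W) (v : V) :
    (graphJoin G H).degree (Sum.inl v) = G.degree v + Fintype.card W := by
  have h : (graphJoin G H).neighborFinset (Sum.inl v) =
      (G.neighborFinset v).disjSum Finset.univ := by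
    ext (x | x) <;> simp
  rw [← card_neighborFinset_eq_degree, h, Finset.card_disjSum, card_neighborFinset_eq_degree,
    Finset.card_univ]

theorem degree_graphJoin_inr {V W : Type*} [Fintype V] [Fintype W] (G : SimpleGraph V)
    (H : SimpleGraph W) (w : W) :
    (graphJoin G H).degree (Sum.inr w) = Fintype.card V + H.degree w := by
  have h : (graphJoin G H).neighborFinset (Sum.inr w) =
      Finset.univ.disjSum (H.neighborFinset w) := by
    ext (x | x) <;> simp
  rw [← card_neighborFinset_eq_degree, h, Finset.card_disjSum, card_neighborFinset_eq_degree,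
    Finset.card_univ]

theorem zfNum_graphJoin_le {V W : Type*} [Fintype V] [Fintype W] (G : SimpleGraph V)
    (H : SimpleGraph W) : zfNum (graphJoin G H) ≤ Fintype.card V + zfNum H := by
  obtain ⟨S, hS, hSc⟩ := exists_isZeroForcingSet_card_eq H
  rw [← hSc, ← Finset.card_univ, ← Finset.card_disjSum]
  refine zfNum_le_card fun B hSB hB => ?_
  have hl : ∀ v, Sum.inl v ∈ B := fun v => hSB (by simp)
  have hr := hS (Sum.inr ⁻¹' B) (fun w hw => hSB (by simpa using hw)) fun u v h =>
    hB (Sum.inr u) (Sum.inr v) ⟨h.1, h.2.1, by simpa using h.2.2.1, by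
      simpa [Sum.forall, hl] using h.2.2.2⟩
  exact Set.eq_univ_of_forall (Sum.forall.mpr ⟨hl, Set.eq_univ_iff_forall.mp hr⟩)

theorem zfNum_pathGraph_le_one (m : ℕ) : zfNum (pathGraph m) ≤ 1 := by
  rcases m with _ | m
  · obtain ⟨S, -, hS⟩ := exists_isZeroForcingSet_card_eq (pathGraph 0)
    rw [← hS, Finset.eq_empty_of_isEmpty S]
    simp
  refine (zfNum_le_card (S := {0}) fun B hSB hB => ?_).trans_eq (Finset.card_singleton _)
  suffices h : ∀ i (hi : i < m + 1), (⟨i, hi⟩ : Fin (m + 1)) ∈ B from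
    Set.eq_univ_of_forall fun i => h i i.isLt
  intro i
  induction i using Nat.strong_induction_on with
  | _ i ih =>
    intro hi
    rcases i with _ | i
    · exact hSB (by simp)
    by_contra hiB
    refine hiB (hB ⟨i, by omega⟩ _ ⟨ih i (by omega) _, hiB, by simp [pathGraph_adj], ?_⟩)
    intro w hw hwB
    rw [pathGraph_adj] at hw
    rcases hw with hw | hw
    · exact Fin.ext hw.symm
    · exact absurd (ih w (by simp at hw; omega) w.isLt) hwB

theorem zfNum_graphJoin_pathGraph {V : Type*} [Fintype V] {G : SimpleGraph V} {m : ℕ}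
    (hG : G.Connected) (hV : 2 ≤ Fintype.card V) (hm : Fintype.card V ≤ m) :
    zfNum (graphJoin G (pathGraph m)) = Fintype.card V + 1 := by
  apply le_antisymm
  · exact (zfNum_graphJoin_le _ _).trans (Nat.add_le_add_left (zfNum_pathGraph_le_one m) _)
  · have : Nontrivial V := Fintype.one_lt_card_iff_nontrivial.mp hV
    have : Nontrivial (Fin m) := Fin.nontrivial_iff_two_le.mpr (hV.trans hm)
    obtain ⟨l, rfl⟩ : ∃ l, m = l + 1 := ⟨m - 1, by omega⟩
    refine le_zfNum_of_forall_le_degree (Sum.forall.mpr ⟨fun v => ?_, fun w => ?_⟩)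
    · rw [degree_graphJoin_inl, Fintype.card_fin]
      have := hG.preconnected.degree_pos_of_nontrivial v
      omega
    · rw [degree_graphJoin_inr]
      have := (pathGraph_connected l).preconnected.degree_pos_of_nontrivial w
      omega

theorem adjMatrix_graphDisjUnion {V W : Type*} (G : SimpleGraph V) (H : SimpleGraph W) :
    (graphDisjUnion G H).adjMatrix ℝ = fromBlocks (G.adjMatrix ℝ) 0 0 (H.adjMatrix ℝ) := by
  rw [graphDisjUnion_eq_sum]
  ext (a | a) (b | b) <;> simp [adjMatrix_apply]

theorem adjMatrix_graphJoin {V W : Type*} (G : SimpleGraph V) (H : SimpleGraph W) :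
    (graphJoin G H).adjMatrix ℝ =
      fromBlocks (G.adjMatrix ℝ) (of fun _ _ => 1) (of fun _ _ => 1) (H.adjMatrix ℝ) := by
  ext (a | a) (b | b) <;> simp [adjMatrix_apply]

/-- The characteristic polynomial of the join of a regular graph with `H`, away from its
roots and the degree, is a Schur complement depending only on the order and the degree. -/
theorem eval_charpoly_adjMatrix_graphJoin {V W : Type*} [Fintype V] [Fintype W] [DecidableEq W]
    {G : SimpleGraph V} {k : ℕ} (hG : G.IsRegularOfDegree k) (H : SimpleGraph W) {x : ℝ}
    (hxk : x ≠ k) (hx : (G.adjMatrix ℝ).charpoly.eval x ≠ 0) :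
    ((graphJoin G H).adjMatrix ℝ).charpoly.eval x =
      (G.adjMatrix ℝ).charpoly.eval x *
        (scalar W x - H.adjMatrix ℝ - of fun _ _ => (Fintype.card V : ℝ) / (x - k)).det := by
  have hxk' : x - k ≠ 0 := sub_ne_zero.mpr hxk
  rw [eval_charpoly] at hx
  have : Invertible (scalar V x - G.adjMatrix ℝ) := invertibleOfIsUnitDet _ hx.isUnit
  have hmul : (scalar V x - G.adjMatrix ℝ) * (of fun (_ : V) (_ : W) => (x - k)⁻¹) =
      of fun _ _ => 1 := by
    ext v w
    rw [Matrix.sub_mul, Matrix.sub_apply, mul_apply (M := G.adjMatrix ℝ)]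
    simp only [scalar_apply, diagonal_mul, of_apply, ← Finset.sum_mul, adjMatrix_apply,
      Finset.sum_boole]
    rw [← neighborFinset_eq_filter, card_neighborFinset_eq_degree, hG.degree_eq v,
      ← _root_.sub_mul]
    exact mul_inv_cancel₀ hxk'
  have hblock : scalar (V ⊕ W) x - (graphJoin G H).adjMatrix ℝ =
      fromBlocks (scalar V x - G.adjMatrix ℝ) (-of fun _ _ => 1) (-of fun _ _ => 1)
        (scalar W x - H.adjMatrix ℝ) := by
    rw [adjMatrix_graphJoin]
    ext (a | a) (b | b) <;> simp [diagonal_apply]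
  rw [eval_charpoly, eval_charpoly, hblock, det_fromBlocks₁₁]
  congr 2
  rw [Matrix.mul_neg, Matrix.neg_mul, Matrix.neg_mul, neg_neg, Matrix.mul_assoc, ← hmul,
    Matrix.invOf_mul_cancel_left]
  ext a b
  simp [mul_apply, div_eq_mul_inv]

theorem charpoly_adjMatrix_graphJoin_mul {V W : Type*} [Fintype V] [Fintype W] [DecidableEq W]
    {G₁ G₂ : SimpleGraph V} {k : ℕ} (h₁ : G₁.IsRegularOfDegree k) (h₂ : G₂.IsRegularOfDegree k)
    (H : SimpleGraph W) :
    ((graphJoin G₁ H).adjMatrix ℝ).charpoly * (G₂.adjMatrix ℝ).charpoly =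
      ((graphJoin G₂ H).adjMatrix ℝ).charpoly * (G₁.adjMatrix ℝ).charpoly := by
  set p := (Polynomial.X - Polynomial.C (k : ℝ)) * (G₁.adjMatrix ℝ).charpoly *
    (G₂.adjMatrix ℝ).charpoly with hp
  have hp0 : p ≠ 0 := mul_ne_zero
    (mul_ne_zero (Polynomial.X_sub_C_ne_zero _) (charpoly_monic _).ne_zero)
    (charpoly_monic _).ne_zero
  refine Polynomial.eq_of_infinite_eval_eq _ _
    ((Polynomial.finite_setOfPred_isRoot hp0).infinite_compl.mono fun x hx => ?_)
  have hx' : p.eval x ≠ 0 := hx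
  simp only [hp, Polynomial.eval_mul, mul_ne_zero_iff, Polynomial.eval_sub, Polynomial.eval_X,
    Polynomial.eval_C, sub_ne_zero] at hx'
  obtain ⟨⟨hxk, hx₁⟩, hx₂⟩ := hx'
  simp only [Set.mem_ofPred_eq, Polynomial.eval_mul,
    eval_charpoly_adjMatrix_graphJoin h₁ H hxk hx₁,
    eval_charpoly_adjMatrix_graphJoin h₂ H hxk hx₂]
  ring

/-- Let `G₁` and `G₂` be connected `k`-regular graphs on a common vertex set of
cardinality `n` with `Z(G₁) ≠ Z(G₂)`, and let `m ≥ n`. Then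
`G' = (G₁ ∨ P_m) ∪ G₂` and `G'' = (G₂ ∨ P_m) ∪ G₁` are non-isomorphic
adjacency-cospectral graphs with `Z(G') = n + Z(G₂) + 1 ≠ n + Z(G₁) + 1 = Z(G'')`. -/
theorem gm_switching_join_path_different_zf {V : Type*} [Fintype V] {n k m : ℕ}
    (hn : Fintype.card V = n)
    (G₁ G₂ : SimpleGraph V) (hc₁ : G₁.Connected) (hc₂ : G₂.Connected)
    (hr₁ : G₁.IsRegularOfDegree k) (hr₂ : G₂.IsRegularOfDegree k)
    (hzf : zfNum G₁ ≠ zfNum G₂) (hm : n ≤ m) :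
    ¬ Nonempty
        ((graphDisjUnion (graphJoin G₁ (pathGraph m)) G₂) ≃g
          (graphDisjUnion (graphJoin G₂ (pathGraph m)) G₁)) ∧
    ((graphDisjUnion (graphJoin G₁ (pathGraph m)) G₂).adjMatrix ℝ).charpoly =
      ((graphDisjUnion (graphJoin G₂ (pathGraph m)) G₁).adjMatrix ℝ).charpoly ∧
    zfNum (graphDisjUnion (graphJoin G₁ (pathGraph m)) G₂) = n + zfNum G₂ + 1 ∧
    zfNum (graphDisjUnion (graphJoin G₂ (pathGraph m)) G₁) = n + zfNum G₁ + 1 ∧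
    zfNum (graphDisjUnion (graphJoin G₁ (pathGraph m)) G₂) ≠
      zfNum (graphDisjUnion (graphJoin G₂ (pathGraph m)) G₁) := by
  subst hn
  have hV : 2 ≤ Fintype.card V := by
    by_contra! hlt
    have : Subsingleton V := Fintype.card_le_one_iff_subsingleton.mp (by omega)
    exact hzf (congrArg (fun G => zfNum G) (Subsingleton.elim G₁ G₂))
  have hz₁ : zfNum (graphDisjUnion (graphJoin G₁ (pathGraph m)) G₂) =
      Fintype.card V + zfNum G₂ + 1 := by
    rw [graphDisjUnion_eq_sum, zfNum_sum, zfNum_graphJoin_pathGraph hc₁ hV hm]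
    omega
  have hz₂ : zfNum (graphDisjUnion (graphJoin G₂ (pathGraph m)) G₁) =
      Fintype.card V + zfNum G₁ + 1 := by
    rw [graphDisjUnion_eq_sum, zfNum_sum, zfNum_graphJoin_pathGraph hc₂ hV hm]
    omega
  have hne : zfNum (graphDisjUnion (graphJoin G₁ (pathGraph m)) G₂) ≠
      zfNum (graphDisjUnion (graphJoin G₂ (pathGraph m)) G₁) := by
    omega
  refine ⟨fun ⟨e⟩ => hne (zfNum_eq_of_iso e), ?_, hz₁, hz₂, hne⟩
  rw [adjMatrix_graphDisjUnion, adjMatrix_graphDisjUnion, charpoly_fromBlocks_zero₁₂,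
    charpoly_fromBlocks_zero₁₂]
  exact charpoly_adjMatrix_graphJoin_mul hr₁ hr₂ _
end

section
/- Let k ≥ 2 and let G be the following 2k-regular graph on 6k vertices. Take the disjoint union of: the k-regular circulant graph H on vertex set {0,…,3k-2} where i is adjacent to k+i,…,2k+i-1 (mod 3k-1); a clique A on vertices a_0,…,a_k; a coclique B on vertices b_0,…,b_k; and a coclique C on vertices c_1,…,c_{k-1}. Add edges: (i) a_i ~ b_j for all 0 ≤ i, j ≤ k with j ≠ i; (ii) c_i ~ j for all 1 ≤ i ≤ k-1 and all j ∈ {0, k, k+1, …, 3k-2}; (iii) b_i ~ j for all 0 ≤ i ≤ k-1 and j ∈ {1,…,k-1}, and b_k ~ j for all j ∈ {2k,…,3k-2}; (iv) b_i ~ k+i-1 for 1 ≤ i ≤ k, and b_0 ~ 0. Let G' be obtained from G by Godsil–McKay switching with respect to the switching set X = V(A) ∪ V(H) (each vertex of B ∪ C has exactly half of X as neighbors; its neighbors in X are replaced by its non-neighbors in X). Then Z(G) ≤ 4k - 2 and Z(G') ≤ 4k - 3. -/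
open SimpleGraph Matrix


/-- The vertex set of the graph `G`: the circulant part `H` (= `ℤ/(3k-1)`), the clique
`A` (vertices `a_0, …, a_k`), the coclique `B` (vertices `b_0, …, b_k`) and the coclique
`C` (vertices `c_1, …, c_{k-1}`). -/
abbrev GMVertex (k : ℕ) : Type :=
  ZMod (3 * k - 1) ⊕ (Fin (k + 1) ⊕ (Fin (k + 1) ⊕ Fin (k - 1)))

/-- The defining relation of the graph `G` (symmetrized by `fromRel`):
within `H` the circulant adjacency; `A` is a clique; `B` and `C` are cocliques;
(i) `a_i ∼ b_j` for `i ≠ j`; (ii) `c_i ∼ j` for `j ∈ {0, k, k+1, …, 3k-2}`;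
(iii) `b_i ∼ j` for `i < k`, `j ∈ {1, …, k-1}` and `b_k ∼ j` for `j ∈ {2k, …, 3k-2}`;
(iv) `b_i ∼ k+i-1` for `1 ≤ i ≤ k` and `b_0 ∼ 0`. -/
def gmRel (k : ℕ) : GMVertex k → GMVertex k → Prop
  | Sum.inl i, Sum.inl j =>
      ∃ t : ℕ, k ≤ t ∧ t ≤ 2 * k - 1 ∧ j = i + (t : ZMod (3 * k - 1))
  | Sum.inr (Sum.inl _), Sum.inr (Sum.inl _) => True
  | Sum.inr (Sum.inl i), Sum.inr (Sum.inr (Sum.inl j)) => (i : ℕ) ≠ (j : ℕ)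
  | Sum.inr (Sum.inr (Sum.inl i)), Sum.inl j =>
      ((i : ℕ) < k ∧ ∃ t : ℕ, 1 ≤ t ∧ t ≤ k - 1 ∧ j = (t : ZMod (3 * k - 1))) ∨
      ((i : ℕ) = k ∧ ∃ t : ℕ, 2 * k ≤ t ∧ t ≤ 3 * k - 2 ∧ j = (t : ZMod (3 * k - 1))) ∨
      (1 ≤ (i : ℕ) ∧ j = ((k + (i : ℕ) - 1 : ℕ) : ZMod (3 * k - 1))) ∨
      ((i : ℕ) = 0 ∧ j = 0)
  | Sum.inr (Sum.inr (Sum.inr _)), Sum.inl j =>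
      j = 0 ∨ ∃ t : ℕ, k ≤ t ∧ t ≤ 3 * k - 2 ∧ j = (t : ZMod (3 * k - 1))
  | _, _ => False

/-- The `2k`-regular graph `G` of order `6k` from the construction. -/
def gmGraph (k : ℕ) : SimpleGraph (GMVertex k) := SimpleGraph.fromRel (gmRel k)

/-- The defining relation of the Godsil–McKay switch `G'` of `G` with respect to the
switching set `X = V(A) ∪ V(H)`: all adjacencies inside `X` and inside `B ∪ C` are kept,
while every vertex of `B ∪ C` exchanges its neighbors in `X` for its non-neighbors
in `X`. -/
def gmRel' (k : ℕ) : GMVertex k → GMVertex k → Prop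
  | Sum.inl i, Sum.inl j =>
      ∃ t : ℕ, k ≤ t ∧ t ≤ 2 * k - 1 ∧ j = i + (t : ZMod (3 * k - 1))
  | Sum.inr (Sum.inl _), Sum.inr (Sum.inl _) => True
  | Sum.inr (Sum.inl i), Sum.inr (Sum.inr (Sum.inl j)) => (i : ℕ) = (j : ℕ)
  | Sum.inr (Sum.inl _), Sum.inr (Sum.inr (Sum.inr _)) => True
  | Sum.inr (Sum.inr (Sum.inl i)), Sum.inl j =>
      ¬ (((i : ℕ) < k ∧ ∃ t : ℕ, 1 ≤ t ∧ t ≤ k - 1 ∧ j = (t : ZMod (3 * k - 1))) ∨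
        ((i : ℕ) = k ∧ ∃ t : ℕ, 2 * k ≤ t ∧ t ≤ 3 * k - 2 ∧ j = (t : ZMod (3 * k - 1))) ∨
        (1 ≤ (i : ℕ) ∧ j = ((k + (i : ℕ) - 1 : ℕ) : ZMod (3 * k - 1))) ∨
        ((i : ℕ) = 0 ∧ j = 0))
  | Sum.inr (Sum.inr (Sum.inr _)), Sum.inl j =>
      ¬ (j = 0 ∨ ∃ t : ℕ, k ≤ t ∧ t ≤ 3 * k - 2 ∧ j = (t : ZMod (3 * k - 1)))
  | _, _ => False

/-- The Godsil–McKay switch `G'` of `G` with respect to `X = V(A) ∪ V(H)`. -/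
def gmGraph' (k : ℕ) : SimpleGraph (GMVertex k) := SimpleGraph.fromRel (gmRel' k)

theorem ZFClosed.mem_of_adj {V : Type*} {G : SimpleGraph V} {B : Set V} (hB : ZFClosed G B)
    {u v : V} (hu : u ∈ B) (huv : G.Adj u v) (h : ∀ w, G.Adj u w → w ≠ v → w ∈ B) : v ∈ B := by
  by_contra hv
  exact hv (hB u v ⟨hu, hv, huv, fun w hw hwB => by_contra fun hne => hwB (h w hw hne)⟩)

theorem zfNum_le_of_isZeroForcingSet {V : Type*} [Fintype V] {G : SimpleGraph V} {S : Finset V}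
    {m : ℕ} (hS : IsZeroForcingSet G ↑S) (hm : S.card ≤ m) : zfNum G ≤ m :=
  le_trans (Nat.sInf_le ⟨S, hS, rfl⟩) hm

theorem zmod_natCast_inj {n a b : ℕ} (ha : a < n) (hb : b < n) :
    (a : ZMod n) = (b : ZMod n) ↔ a = b := by
  rw [ZMod.natCast_eq_natCast_iff', Nat.mod_eq_of_lt ha, Nat.mod_eq_of_lt hb]

theorem exists_zmod_natCast_eq_iff {n lo hi j : ℕ} (hj : j < n) (hhi : hi < n) :
    (∃ t : ℕ, lo ≤ t ∧ t ≤ hi ∧ (j : ZMod n) = (t : ZMod n)) ↔ lo ≤ j ∧ j ≤ hi := by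
  constructor
  · rintro ⟨t, h1, h2, h3⟩
    rw [zmod_natCast_inj hj (by omega)] at h3
    omega
  · rintro ⟨h1, h2⟩
    exact ⟨j, h1, h2, rfl⟩

theorem exists_zmod_natCast_eq {n : ℕ} [NeZero n] (x : ZMod n) :
    ∃ t : ℕ, t < n ∧ x = (t : ZMod n) :=
  ⟨x.val, x.val_lt, (ZMod.natCast_zmod_val x).symm⟩

theorem circulant_rel_iff {k a b : ℕ} (ha : a < 3 * k - 1) (hb : b < 3 * k - 1) :
    (∃ t : ℕ, k ≤ t ∧ t ≤ 2 * k - 1 ∧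
      (b : ZMod (3 * k - 1)) = (a : ZMod (3 * k - 1)) + (t : ZMod (3 * k - 1))) ↔
    (k + a ≤ b ∧ b < a + 2 * k) ∨ (k + b ≤ a ∧ a < b + 2 * k) := by
  constructor
  · rintro ⟨t, h1, h2, h3⟩
    rw [← Nat.cast_add, ZMod.natCast_eq_natCast_iff', Nat.mod_eq_of_lt hb] at h3
    by_cases h : a + t < 3 * k - 1
    · rw [Nat.mod_eq_of_lt h] at h3
      omega
    · rw [Nat.mod_eq_sub_mod (by omega), Nat.mod_eq_of_lt (by omega)] at h3
      omega
  · rintro (⟨h1, h2⟩ | ⟨h1, h2⟩)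
    · refine ⟨b - a, by omega, by omega, ?_⟩
      rw [← Nat.cast_add]
      congr 1
      omega
    · refine ⟨b + (3 * k - 1) - a, by omega, by omega, ?_⟩
      rw [← Nat.cast_add, show a + (b + (3 * k - 1) - a) = b + (3 * k - 1) by omega]
      simp

/-- The vertex `t` of the circulant part. -/
abbrev hVertex (k t : ℕ) : GMVertex k := Sum.inl (t : ZMod (3 * k - 1))

/-- The vertex `a_i`. -/
abbrev aVertex (k : ℕ) (i : Fin (k + 1)) : GMVertex k := Sum.inr (Sum.inl i)

/-- The vertex `b_i`. -/
abbrev bVertex (k : ℕ) (i : Fin (k + 1)) : GMVertex k := Sum.inr (Sum.inr (Sum.inl i))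

/-- The vertex `c_{i+1}`. -/
abbrev cVertex (k : ℕ) (i : Fin (k - 1)) : GMVertex k := Sum.inr (Sum.inr (Sum.inr i))

theorem forall_gmVertex {k : ℕ} [NeZero (3 * k - 1)] {P : GMVertex k → Prop}
    (hH : ∀ t, t < 3 * k - 1 → P (hVertex k t)) (hA : ∀ i, P (aVertex k i))
    (hB : ∀ i, P (bVertex k i)) (hC : ∀ i, P (cVertex k i)) : ∀ v, P v := by
  rintro (x | i | i | i)
  · obtain ⟨t, ht, rfl⟩ := exists_zmod_natCast_eq x
    exact hH t ht
  · exact hA i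
  · exact hB i
  · exact hC i

theorem hVertex_inj {k s t : ℕ} (hs : s < 3 * k - 1) (ht : t < 3 * k - 1) :
    hVertex k s = hVertex k t ↔ s = t := by
  rw [Sum.inl.injEq, zmod_natCast_inj hs ht]

/-- The neighbors in `H` of `b_i` in the graph `G`. -/
def bRel (k i t : ℕ) : Prop :=
  (i < k ∧ 1 ≤ t ∧ t ≤ k - 1) ∨ (i = k ∧ 2 * k ≤ t ∧ t ≤ 3 * k - 2) ∨
    (1 ≤ i ∧ t = k + i - 1) ∨ (i = 0 ∧ t = 0)

theorem bRel_iff {k i t : ℕ} (hk : 1 ≤ k) (hi : i ≤ k) (ht : t < 3 * k - 1) :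
    ((i < k ∧ ∃ s : ℕ, 1 ≤ s ∧ s ≤ k - 1 ∧ (t : ZMod (3 * k - 1)) = (s : ZMod (3 * k - 1))) ∨
      (i = k ∧ ∃ s : ℕ, 2 * k ≤ s ∧ s ≤ 3 * k - 2 ∧
        (t : ZMod (3 * k - 1)) = (s : ZMod (3 * k - 1))) ∨
      (1 ≤ i ∧ (t : ZMod (3 * k - 1)) = ((k + i - 1 : ℕ) : ZMod (3 * k - 1))) ∨
      (i = 0 ∧ (t : ZMod (3 * k - 1)) = 0)) ↔ bRel k i t := by
  have h0 : (t : ZMod (3 * k - 1)) = 0 ↔ t = 0 := by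
    rw [← Nat.cast_zero, zmod_natCast_inj ht (by omega)]
  rw [exists_zmod_natCast_eq_iff ht (by omega), exists_zmod_natCast_eq_iff ht (by omega),
    zmod_natCast_inj ht (by omega), h0, bRel]

theorem cRel_iff {k t : ℕ} (hk : 1 ≤ k) (ht : t < 3 * k - 1) :
    ((t : ZMod (3 * k - 1)) = 0 ∨ ∃ s : ℕ, k ≤ s ∧ s ≤ 3 * k - 2 ∧
      (t : ZMod (3 * k - 1)) = (s : ZMod (3 * k - 1))) ↔ t = 0 ∨ k ≤ t := by
  have h0 : (t : ZMod (3 * k - 1)) = 0 ↔ t = 0 := by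
    rw [← Nat.cast_zero, zmod_natCast_inj ht (by omega)]
  rw [exists_zmod_natCast_eq_iff ht (by omega), h0]
  omega

section Adjacency

variable {k : ℕ}

theorem gmGraph_adj_hh {s t : ℕ} (hk : 1 ≤ k) (hs : s < 3 * k - 1) (ht : t < 3 * k - 1) :
    (gmGraph k).Adj (hVertex k s) (hVertex k t) ↔
      (k + s ≤ t ∧ t < s + 2 * k) ∨ (k + t ≤ s ∧ s < t + 2 * k) := by
  rw [gmGraph, fromRel_adj, Ne, hVertex_inj hs ht]
  simp only [gmRel]
  rw [circulant_rel_iff hs ht, circulant_rel_iff ht hs]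
  omega

theorem gmGraph_adj_hb {t : ℕ} {i : Fin (k + 1)} (hk : 1 ≤ k) (ht : t < 3 * k - 1) :
    (gmGraph k).Adj (hVertex k t) (bVertex k i) ↔ bRel k i t := by
  rw [← bRel_iff hk (by omega) ht]
  simp [gmGraph, fromRel_adj, gmRel]

theorem gmGraph_adj_hc {t : ℕ} {i : Fin (k - 1)} (hk : 1 ≤ k) (ht : t < 3 * k - 1) :
    (gmGraph k).Adj (hVertex k t) (cVertex k i) ↔ t = 0 ∨ k ≤ t := by
  rw [← cRel_iff hk ht]
  simp [gmGraph, fromRel_adj, gmRel]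

theorem gmGraph_not_adj_ha {t : ℕ} {i : Fin (k + 1)} :
    ¬ (gmGraph k).Adj (hVertex k t) (aVertex k i) := by
  simp [gmGraph, fromRel_adj, gmRel]

theorem gmGraph_adj_ba {i j : Fin (k + 1)} :
    (gmGraph k).Adj (bVertex k i) (aVertex k j) ↔ i ≠ j := by
  simp [gmGraph, fromRel_adj, gmRel, Fin.ext_iff, eq_comm]

theorem gmGraph_not_adj_ca {i : Fin (k - 1)} {j : Fin (k + 1)} :
    ¬ (gmGraph k).Adj (cVertex k i) (aVertex k j) := by
  simp [gmGraph, fromRel_adj, gmRel]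

theorem gmGraph_not_adj_cb {i : Fin (k - 1)} {j : Fin (k + 1)} :
    ¬ (gmGraph k).Adj (cVertex k i) (bVertex k j) := by
  simp [gmGraph, fromRel_adj, gmRel]

theorem gmGraph'_adj_hh {s t : ℕ} (hk : 1 ≤ k) (hs : s < 3 * k - 1) (ht : t < 3 * k - 1) :
    (gmGraph' k).Adj (hVertex k s) (hVertex k t) ↔
      (k + s ≤ t ∧ t < s + 2 * k) ∨ (k + t ≤ s ∧ s < t + 2 * k) := by
  rw [gmGraph', fromRel_adj, Ne, hVertex_inj hs ht]
  simp only [gmRel']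
  rw [circulant_rel_iff hs ht, circulant_rel_iff ht hs]
  omega

theorem gmGraph'_adj_bh {t : ℕ} {i : Fin (k + 1)} (hk : 1 ≤ k) (ht : t < 3 * k - 1) :
    (gmGraph' k).Adj (bVertex k i) (hVertex k t) ↔ ¬ bRel k i t := by
  rw [← bRel_iff hk (by omega) ht, gmGraph', fromRel_adj]
  simp only [gmRel', or_false, ne_eq, reduceCtorEq, not_false_eq_true, true_and]

theorem gmGraph'_adj_ch {t : ℕ} {i : Fin (k - 1)} (hk : 1 ≤ k) (ht : t < 3 * k - 1) :
    (gmGraph' k).Adj (cVertex k i) (hVertex k t) ↔ 1 ≤ t ∧ t < k := by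
  have h := cRel_iff hk ht
  rw [gmGraph', fromRel_adj]
  simp only [gmRel', or_false, ne_eq, reduceCtorEq, not_false_eq_true, true_and]
  rw [h]
  omega

theorem gmGraph'_not_adj_ah {t : ℕ} {i : Fin (k + 1)} :
    ¬ (gmGraph' k).Adj (aVertex k i) (hVertex k t) := by
  simp [gmGraph', fromRel_adj, gmRel']

theorem gmGraph'_adj_ab {i j : Fin (k + 1)} :
    (gmGraph' k).Adj (aVertex k i) (bVertex k j) ↔ i = j := by
  simp [gmGraph', fromRel_adj, gmRel', Fin.ext_iff]

end Adjacency

theorem eq_univ_of_zfClosed_gmGraph {k : ℕ} (hk : 2 ≤ k) [NeZero (3 * k - 1)]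
    {B : Set (GMVertex k)} (hB : ZFClosed (gmGraph k) B)
    (hH : ∀ t, k ≤ t → t < 3 * k - 1 → hVertex k t ∈ B)
    (hA : ∀ i : Fin (k + 1), 2 ≤ (i : ℕ) → aVertex k i ∈ B)
    (hb : bVertex k (Fin.last k) ∈ B) (hC : ∀ i, cVertex k i ∈ B) : B = Set.univ := by
  have hH0 : hVertex k 0 ∈ B := by
    refine hB.mem_of_adj (hC ⟨0, by omega⟩)
      ((gmGraph_adj_hc (by omega) (by omega)).2 (Or.inl rfl)).symm
      (forall_gmVertex (fun t ht h hne => ?_) (fun i h => ?_) (fun i h => ?_) fun i _ _ => hC i)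
    · rw [SimpleGraph.adj_comm, gmGraph_adj_hc (by omega) ht] at h
      rw [Ne, hVertex_inj ht (by omega)] at hne
      exact hH t (by omega) ht
    · exact (gmGraph_not_adj_ca h).elim
    · exact (gmGraph_not_adj_cb h).elim
  have hb0 : bVertex k 0 ∈ B := by
    refine hB.mem_of_adj hH0 ((gmGraph_adj_hb (by omega) (by omega)).2 (by simp [bRel]))
      (forall_gmVertex (fun t ht h _ => ?_) (fun i h => ?_) (fun i h hne => ?_) fun i _ _ => hC i)
    · rw [gmGraph_adj_hh (by omega) (by omega) ht] at h
      exact hH t (by omega) ht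
    · exact (gmGraph_not_adj_ha h).elim
    · rw [gmGraph_adj_hb (by omega) (by omega), bRel] at h
      have : i = 0 := Fin.ext (by simp only [Fin.val_zero]; omega)
      exact (hne (by rw [this])).elim
  have hHrev : ∀ r s, r + s + 1 = k → 1 ≤ s → hVertex k s ∈ B := by
    intro r
    induction r using Nat.strong_induction_on with
    | _ r ih =>
      intro s hrs hs
      refine hB.mem_of_adj (hH (2 * k + s - 1) (by omega) (by omega))
        ((gmGraph_adj_hh (by omega) (by omega) (by omega)).2 (by omega))
        (forall_gmVertex (fun t ht h hne => ?_) (fun i h => ?_) (fun i h _ => ?_)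
          fun i _ _ => hC i)
      · rw [gmGraph_adj_hh (by omega) (by omega) ht] at h
        rw [Ne, hVertex_inj ht (by omega)] at hne
        by_cases htk : k ≤ t
        · exact hH t htk ht
        · exact ih (k - 1 - t) (by omega) t (by omega) (by omega)
      · exact (gmGraph_not_adj_ha h).elim
      · rw [gmGraph_adj_hb (by omega) (by omega), bRel] at h
        have : i = Fin.last k := Fin.ext (by simp only [Fin.val_last]; omega)
        exact this ▸ hb
  have hHall : ∀ t, t < 3 * k - 1 → hVertex k t ∈ B := by
    intro t ht
    rcases Nat.eq_zero_or_pos t with rfl | h0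
    · exact hH0
    · by_cases htk : k ≤ t
      · exact hH t htk ht
      · exact hHrev (k - 1 - t) t (by omega) h0
  have hBall : ∀ i, bVertex k i ∈ B := by
    intro i
    by_cases hi0 : (i : ℕ) = 0
    · exact (Fin.ext hi0 : i = 0) ▸ hb0
    by_cases hik : (i : ℕ) = k
    · exact (Fin.ext hik : i = Fin.last k) ▸ hb
    refine hB.mem_of_adj (hHall (k + i - 1) (by omega))
      ((gmGraph_adj_hb (by omega) (by omega)).2 (by rw [bRel]; omega))
      (forall_gmVertex (fun t ht _ _ => hHall t ht) (fun j h => ?_) (fun j h hne => ?_)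
        fun i _ _ => hC i)
    · exact (gmGraph_not_adj_ha h).elim
    · rw [gmGraph_adj_hb (by omega) (by omega), bRel] at h
      have : j = i := Fin.ext (by omega)
      exact (hne (by rw [this])).elim
  have hforce : ∀ i j : Fin (k + 1), (i : ℕ) + j = 1 → aVertex k j ∈ B := by
    intro i j hij
    refine hB.mem_of_adj (hBall i) (gmGraph_adj_ba.2 (by rintro rfl; omega))
      (forall_gmVertex (fun t ht _ _ => hHall t ht) (fun l h hne => ?_) (fun l _ _ => hBall l)
        fun i _ _ => hC i)
    have h1 : (i : ℕ) ≠ l := fun e => gmGraph_adj_ba.1 h (Fin.ext e)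
    have h2 : (l : ℕ) ≠ j := fun e => hne (by rw [Fin.ext e])
    exact hA l (by omega)
  refine Set.eq_univ_of_forall (forall_gmVertex hHall (fun i => ?_) hBall hC)
  by_cases hi : 2 ≤ (i : ℕ)
  · exact hA i hi
  · exact hforce ⟨1 - i, by omega⟩ i (by simp only; omega)

theorem eq_univ_of_zfClosed_gmGraph' {k : ℕ} (hk : 2 ≤ k) [NeZero (3 * k - 1)]
    {B : Set (GMVertex k)} (hB : ZFClosed (gmGraph' k) B)
    (hH : ∀ t, 2 ≤ t → t < 2 * k - 1 → hVertex k t ∈ B)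
    (hA : ∀ i, aVertex k i ∈ B) (hC : ∀ i, cVertex k i ∈ B) : B = Set.univ := by
  have hBall : ∀ i, bVertex k i ∈ B := by
    intro i
    refine hB.mem_of_adj (hA i) (gmGraph'_adj_ab.2 rfl)
      (forall_gmVertex (fun t ht h => ?_) (fun i _ _ => hA i) (fun j h hne => ?_)
        fun i _ _ => hC i)
    · exact (gmGraph'_not_adj_ah h).elim
    · exact (hne (by rw [gmGraph'_adj_ab.1 h])).elim
  have hH1 : hVertex k 1 ∈ B := by
    refine hB.mem_of_adj (hC ⟨0, by omega⟩)
      ((gmGraph'_adj_ch (by omega) (by omega)).2 (by omega))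
      (forall_gmVertex (fun t ht h hne => ?_) (fun i _ _ => hA i) (fun i _ _ => hBall i)
        fun i _ _ => hC i)
    rw [gmGraph'_adj_ch (by omega) ht] at h
    rw [Ne, hVertex_inj ht (by omega)] at hne
    exact hH t (by omega) (by omega)
  have hH0 : hVertex k 0 ∈ B := by
    refine hB.mem_of_adj (hBall (Fin.last k))
      ((gmGraph'_adj_bh (by omega) (by omega)).2 (by rw [bRel, Fin.val_last]; omega))
      (forall_gmVertex (fun t ht h hne => ?_) (fun i _ _ => hA i) (fun i _ _ => hBall i)
        fun i _ _ => hC i)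
    rw [gmGraph'_adj_bh (by omega) ht, bRel, Fin.val_last] at h
    rw [Ne, hVertex_inj ht (by omega)] at hne
    by_cases h1 : t = 1
    · exact h1 ▸ hH1
    · exact hH t (by omega) (by omega)
  have hHall : ∀ t, t < 3 * k - 1 → hVertex k t ∈ B := by
    intro t
    induction t using Nat.strong_induction_on with
    | _ t ih =>
      intro ht
      by_cases h0 : t = 0
      · exact h0 ▸ hH0
      by_cases h1 : t = 1
      · exact h1 ▸ hH1
      by_cases h2 : t < 2 * k - 1
      · exact hH t (by omega) h2
      refine hB.mem_of_adj (ih (t - (2 * k - 1)) (by omega) (by omega))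
        ((gmGraph'_adj_hh (by omega) (by omega) ht).2 (by omega))
        (forall_gmVertex (fun s hs h hne => ?_) (fun i _ _ => hA i) (fun i _ _ => hBall i)
          fun i _ _ => hC i)
      rw [gmGraph'_adj_hh (by omega) (by omega) hs] at h
      rw [Ne, hVertex_inj hs ht] at hne
      exact ih s (by omega) hs
  exact Set.eq_univ_of_forall (forall_gmVertex hHall hA hBall hC)

theorem zfNum_gmGraph_le_of_two_le {k : ℕ} (hk : 2 ≤ k) [NeZero (3 * k - 1)] :
    zfNum (gmGraph k) ≤ 4 * k - 2 := by
  let S : Finset (GMVertex k) :=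
    ((Finset.Ico k (3 * k - 1)).image (Nat.cast : ℕ → ZMod (3 * k - 1))).disjSum
      (Finset.disjSum ({0, 1}ᶜ) (Finset.disjSum {Fin.last k} Finset.univ))
  refine zfNum_le_of_isZeroForcingSet (S := S) (fun B hSB hB => ?_) ?_
  · refine eq_univ_of_zfClosed_gmGraph hk hB (fun t h1 h2 => hSB ?_) (fun i hi => hSB ?_)
      (hSB ?_) (fun i => hSB ?_)
    · simp only [S, Finset.mem_coe, Finset.inl_mem_disjSum]
      exact Finset.mem_image_of_mem _ (Finset.mem_Ico.2 ⟨h1, h2⟩)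
    · have h0 : i ≠ 0 := by rintro rfl; simp at hi
      have h1 : i ≠ 1 := by
        rintro rfl
        rw [Fin.val_one', Nat.mod_eq_of_lt (by omega)] at hi
        omega
      simp [S, h0, h1]
    · simp [S]
    · simp [S]
  · have h1 := Finset.card_image_le (s := Finset.Ico k (3 * k - 1))
      (f := (Nat.cast : ℕ → ZMod (3 * k - 1)))
    have h2 : (0 : Fin (k + 1)) ≠ 1 := by
      rw [Ne, Fin.ext_iff, Fin.val_one', Nat.mod_eq_of_lt (by omega)]
      simp
    simp only [S, Finset.card_disjSum, Finset.card_compl, Finset.card_pair h2, Fintype.card_fin,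
      Finset.card_singleton, Finset.card_univ]
    rw [Nat.card_Ico] at h1
    omega

theorem zfNum_gmGraph'_le_of_two_le {k : ℕ} (hk : 2 ≤ k) [NeZero (3 * k - 1)] :
    zfNum (gmGraph' k) ≤ 4 * k - 3 := by
  let S : Finset (GMVertex k) :=
    ((Finset.Ico 2 (2 * k - 1)).image (Nat.cast : ℕ → ZMod (3 * k - 1))).disjSum
      (Finset.disjSum Finset.univ (Finset.disjSum ∅ Finset.univ))
  refine zfNum_le_of_isZeroForcingSet (S := S) (fun B hSB hB => ?_) ?_
  · refine eq_univ_of_zfClosed_gmGraph' hk hB (fun t h1 h2 => hSB ?_) (fun i => hSB ?_)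
      (fun i => hSB ?_)
    · simp only [S, Finset.mem_coe, Finset.inl_mem_disjSum]
      exact Finset.mem_image_of_mem _ (Finset.mem_Ico.2 ⟨h1, h2⟩)
    · simp [S]
    · simp [S]
  · have h1 := Finset.card_image_le (s := Finset.Ico 2 (2 * k - 1))
      (f := (Nat.cast : ℕ → ZMod (3 * k - 1)))
    simp only [S, Finset.card_disjSum, Fintype.card_fin, Finset.card_empty, Finset.card_univ]
    rw [Nat.card_Ico] at h1
    omega

/-- For `k ≥ 2`, the graph `G` of the construction satisfies `Z(G) ≤ 4k - 2` and its
Godsil–McKay switch `G'` satisfies `Z(G') ≤ 4k - 3`. -/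
theorem zfNum_gmGraph_le (k : ℕ) (hk : 2 ≤ k) [NeZero (3 * k - 1)] :
    zfNum (gmGraph k) ≤ 4 * k - 2 ∧ zfNum (gmGraph' k) ≤ 4 * k - 3 :=
  ⟨zfNum_gmGraph_le_of_two_le hk, zfNum_gmGraph'_le_of_two_le hk⟩
end
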